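/- arXiv:2603.28706 — 4 statements merged into one kernel-verified Lean document; each statement's English description precedes it below -/
import Mathlib

section
/- Fix ν∞ ≥ 0, ν > 0, δ > 0 and p > 1. Then for every real d×d matrix A, the exact constitutive tangent T_A is positive definite: ⟨T_A(B),B⟩ > 0 for every nonzero real d×d matrix B. Equivalently, both eigenvalues λ⊥(A) = η(A) and λ∥(A) = ν∞ + ν(δ² + |A|²)^{(p−4)/2}(δ² + (p−1)|A|²) are strictly positive. -/
open scoped RealInnerProductSpace

/-- The quadratic form `(δ² + |A|²)|B|² + (p - 2)⟪A, B⟫²` is positive definite for `p > 1`. -/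
theorem tangent_quadratic_form_pos {E : Type*} [NormedAddCommGroup E] [InnerProductSpace ℝ E]
    {δ p : ℝ} (hδ : 0 < δ) (hp : 1 < p) (A : E) {B : E} (hB : B ≠ 0) :
    0 < (δ ^ 2 + ‖A‖ ^ 2) * ‖B‖ ^ 2 + (p - 2) * ⟪A, B⟫ ^ 2 := by
  have hB' : 0 < ‖B‖ := norm_pos_iff.mpr hB
  have hCS : ⟪A, B⟫ ^ 2 ≤ ‖A‖ ^ 2 * ‖B‖ ^ 2 := by
    rw [← mul_pow]
    exact sq_le_sq' (neg_le_of_abs_le (abs_real_inner_le_norm A B)) (real_inner_le_norm A B)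
  have h₁ : 0 < δ ^ 2 * ‖B‖ ^ 2 := by positivity
  have h₂ : 0 ≤ (p - 1) * ⟪A, B⟫ ^ 2 := mul_nonneg (by linarith) (sq_nonneg _)
  linarith

/-- For `ν∞ ≥ 0`, `ν > 0`, `δ > 0` and `p > 1`, the exact constitutive tangent
`T_A(B) = η(A) • B + β(A) ⟪A, B⟫ • A` (with `η(A) = ν∞ + ν (δ² + |A|²)^((p-2)/2)` and
`β(A) = ν (p-2) (δ² + |A|²)^((p-4)/2)`) is positive definite, and equivalently both
eigenvalues `λ⊥(A) = η(A)` and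
`λ∥(A) = ν∞ + ν (δ² + |A|²)^((p-4)/2) (δ² + (p-1)|A|²)` are strictly positive. -/
theorem stmt_4 (d : ℕ) (νinf ν δ p : ℝ) (hνinf : 0 ≤ νinf) (hν : 0 < ν) (hδ : 0 < δ)
    (hp : 1 < p) (A : EuclideanSpace ℝ (Fin d × Fin d)) :
    (∀ B : EuclideanSpace ℝ (Fin d × Fin d), B ≠ 0 →
      0 < ⟪(νinf + ν * (δ ^ 2 + ‖A‖ ^ 2) ^ ((p - 2) / 2)) • B +
            (ν * (p - 2) * (δ ^ 2 + ‖A‖ ^ 2) ^ ((p - 4) / 2) * ⟪A, B⟫) • A, B⟫) ∧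
    0 < νinf + ν * (δ ^ 2 + ‖A‖ ^ 2) ^ ((p - 2) / 2) ∧
    0 < νinf + ν * (δ ^ 2 + ‖A‖ ^ 2) ^ ((p - 4) / 2) * (δ ^ 2 + (p - 1) * ‖A‖ ^ 2) := by
  have hs : 0 < δ ^ 2 + ‖A‖ ^ 2 := by positivity
  refine ⟨fun B hB => ?_, by positivity, ?_⟩
  · have hpow : (δ ^ 2 + ‖A‖ ^ 2) ^ ((p - 2) / 2) =
        (δ ^ 2 + ‖A‖ ^ 2) ^ ((p - 4) / 2) * (δ ^ 2 + ‖A‖ ^ 2) := by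
      rw [← Real.rpow_add_one hs.ne']
      ring_nf
    rw [inner_add_left, real_inner_smul_left, real_inner_smul_left, real_inner_self_eq_norm_sq,
      hpow]
    have hq := tangent_quadratic_form_pos hδ hp A hB
    have hpos := Real.rpow_pos_of_pos hs ((p - 4) / 2)
    have h₁ : 0 ≤ νinf * ‖B‖ ^ 2 := by positivity
    have h₂ := mul_pos (mul_pos hν hpos) hq
    linarith
  · have hp' : 0 < p - 1 := by linarith
    positivity
end

section
/- Fix 1 < p < 2 and an integer m ≥ 1. There exists a constant C_m > 0, depending only on m, p and the dimension d, such that for all ν∞ ≥ 0, ν > 0, δ > 0 and every real d×d matrix A, the m-th derivative of the regularized stress S satisfies ‖D^m S(A)‖ ≤ C_m·(ν∞·𝟙_{m=1} + ν·δ^{p−1−m}), where ‖·‖ denotes the norm of the m-linear map D^m S(A) and 𝟙_{m=1} equals 1 if m = 1 and 0 otherwise. -/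
/-- The derivatives of positive order of the identity. -/
theorem norm_iteratedFDeriv_id_le {E : Type*} [NormedAddCommGroup E] [NormedSpace ℝ E]
    {n : ℕ} (hn : 1 ≤ n) (x : E) :
    ‖iteratedFDeriv ℝ n (fun y : E => y) x‖ ≤ if n = 1 then 1 else 0 := by
  obtain ⟨k, rfl⟩ : ∃ k, n = k + 1 := ⟨n - 1, by omega⟩
  rw [← norm_iteratedFDeriv_fderiv]
  have h : fderiv ℝ (fun y : E => y) = fun _ => ContinuousLinearMap.id ℝ E := by
    ext1 y
    exact fderiv_fun_id
  rw [h]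
  rcases Nat.eq_zero_or_pos k with rfl | hk
  · simpa using ContinuousLinearMap.norm_id_le (𝕜 := ℝ) (E := E)
  · rw [iteratedFDeriv_const_of_ne (by omega)]
    simp [hk.ne']

theorem norm_iteratedFDeriv_id_le_mul_inv_pow {E : Type*} [NormedAddCommGroup E]
    [NormedSpace ℝ E] {r : ℝ} (hr : 0 < r) {x : E} (hx : ‖x‖ ≤ r) (n : ℕ) :
    ‖iteratedFDeriv ℝ n (fun y : E => y) x‖ ≤ r * r⁻¹ ^ n := by
  rcases Nat.eq_zero_or_pos n with rfl | hn
  · simpa using hx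
  · refine (norm_iteratedFDeriv_id_le hn x).trans ?_
    split_ifs with h
    · subst h
      rw [pow_one, mul_inv_cancel₀ hr.ne']
    · positivity

/-- Leibniz' rule for functions whose derivatives scale like powers of `r⁻¹`. -/
theorem sum_choose_mul_le {a b : ℕ → ℝ} {K L c r : ℝ} {n : ℕ} (hL : 0 ≤ L)
    (hK : 0 ≤ K) (hr : 0 < r) (hc : 1 ≤ c) (hb : ∀ i, 0 ≤ b i)
    (ha' : ∀ i ≤ n, a i ≤ K * (c * r⁻¹) ^ i) (hb' : ∀ i, b i ≤ L * r⁻¹ ^ i) :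
    ∑ i ∈ Finset.range (n + 1), (n.choose i : ℝ) * a i * b (n - i) ≤
      K * L * (2 * c * r⁻¹) ^ n := by
  have key : ∀ i ∈ Finset.range (n + 1), (n.choose i : ℝ) * a i * b (n - i) ≤
      (n.choose i : ℝ) * (K * L * (c * r⁻¹) ^ n) := by
    intro i hi
    have hin : i ≤ n := Nat.lt_succ_iff.mp (Finset.mem_range.mp hi)
    rw [mul_assoc]
    refine mul_le_mul_of_nonneg_left ?_ (Nat.cast_nonneg _)
    calc a i * b (n - i) ≤ (K * (c * r⁻¹) ^ i) * (L * r⁻¹ ^ (n - i)) :=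
          mul_le_mul (ha' i hin) (hb' _) (hb _) (by positivity)
      _ = K * L * (c ^ i * (r⁻¹ ^ i * r⁻¹ ^ (n - i))) := by rw [mul_pow]; ring
      _ = K * L * (c ^ i * r⁻¹ ^ n) := by rw [← pow_add, Nat.add_sub_cancel' hin]
      _ ≤ K * L * (c ^ n * r⁻¹ ^ n) := by gcongr
      _ = K * L * (c * r⁻¹) ^ n := by rw [mul_pow]
  refine (Finset.sum_le_sum key).trans_eq ?_
  rw [← Finset.sum_mul, ← Nat.cast_sum, Nat.sum_range_choose, mul_assoc 2 c, mul_pow 2]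
  push_cast
  ring

theorem norm_iteratedFDeriv_norm_sq_le {E : Type*} [NormedAddCommGroup E]
    [InnerProductSpace ℝ E] {r : ℝ} (hr : 0 < r) {x : E} (hx : ‖x‖ ≤ r) (n : ℕ) :
    ‖iteratedFDeriv ℝ n (fun y : E => ‖y‖ ^ 2) x‖ ≤ r ^ 2 * (2 * r⁻¹) ^ n := by
  have h : (fun y : E => ‖y‖ ^ 2) = fun y : E => innerSL ℝ y y := by
    ext y
    rw [innerSL_apply_apply, real_inner_self_eq_norm_sq]
  rw [h]
  refine ((innerSL ℝ : E →L[ℝ] E →L[ℝ] ℝ).norm_iteratedFDeriv_le_of_bilinear_of_le_one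
    (N := n) contDiff_fun_id contDiff_fun_id x le_rfl (norm_innerSL_le ℝ)).trans ?_
  have hid := norm_iteratedFDeriv_id_le_mul_inv_pow hr hx
  refine (sum_choose_mul_le (a := fun i => ‖iteratedFDeriv ℝ i (fun y : E => y) x‖)
    (b := fun i => ‖iteratedFDeriv ℝ i (fun y : E => y) x‖) (K := r) (L := r) (c := 1)
    hr.le hr.le hr le_rfl (fun _ => norm_nonneg _) (fun i _ => by simpa using hid i) hid).trans_eq ?_
  ring

theorem contDiff_add_norm_sq_rpow {E : Type*} [NormedAddCommGroup E]
    [InnerProductSpace ℝ E] {δ : ℝ} (hδ : 0 < δ) (s : ℝ) {n : WithTop ℕ∞} :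
    ContDiff ℝ n (fun y : E => (δ ^ 2 + ‖y‖ ^ 2) ^ s) :=
  (contDiff_const.add (contDiff_norm_sq ℝ)).rpow_const_of_ne fun y => by positivity

theorem exists_norm_iteratedFDeriv_add_norm_sq_rpow_le (E : Type*) [NormedAddCommGroup E]
    [InnerProductSpace ℝ E] (s : ℝ) (m : ℕ) :
    ∃ K : ℝ, 0 ≤ K ∧ ∀ δ r : ℝ, 0 < δ → 0 < r → ∀ x : E, δ ^ 2 + ‖x‖ ^ 2 = r ^ 2 →
      ∀ n ≤ m, ‖iteratedFDeriv ℝ n (fun y : E => (δ ^ 2 + ‖y‖ ^ 2) ^ s) x‖ ≤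
        K * (r ^ 2) ^ s * (2 * r⁻¹) ^ n := by
  set g : ℝ → ℝ := fun t => t ^ s
  set M : ℝ := ∑ i ∈ Finset.range (m + 1), ‖iteratedFDerivWithin ℝ i g (Set.Ioi 0) 1‖
  have hM0 : 0 ≤ M := Finset.sum_nonneg fun _ _ => norm_nonneg _
  refine ⟨m.factorial * M, by positivity, fun δ r hδ hr x hx n hn => ?_⟩
  have hxr : ‖x‖ ≤ r := by
    refine le_of_sq_le_sq ?_ hr.le
    nlinarith
  set f : E → ℝ := fun y => (r ^ 2)⁻¹ * δ ^ 2 + (r ^ 2)⁻¹ * ‖y‖ ^ 2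
  have hfpos : ∀ y, 0 < f y := fun y => by positivity
  have hfx : f x = 1 := by
    change (r ^ 2)⁻¹ * δ ^ 2 + (r ^ 2)⁻¹ * ‖x‖ ^ 2 = 1
    rw [← mul_add, hx, inv_mul_cancel₀ (by positivity)]
  have hsq : ∀ {k : WithTop ℕ∞}, ContDiff ℝ k (fun y : E => ‖y‖ ^ 2) := contDiff_norm_sq ℝ
  have hsq' : ∀ {k : WithTop ℕ∞}, ContDiff ℝ k (fun y : E => (r ^ 2)⁻¹ * ‖y‖ ^ 2) :=
    contDiff_const.mul hsq
  have hf : ContDiff ℝ n f := contDiff_const.add hsq'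
  have hg : ContDiffOn ℝ n g (Set.Ioi 0) :=
    contDiffOn_id.rpow_const_of_ne fun t ht => (Set.mem_Ioi.mp ht).ne'
  have hfac : (fun y : E => (δ ^ 2 + ‖y‖ ^ 2) ^ s) = fun y => (r ^ 2) ^ s • (g ∘ f) y := by
    ext y
    rw [smul_eq_mul, Function.comp_apply, ← Real.mul_rpow (by positivity) (hfpos y).le]
    congr 1
    simp only [f]
    field_simp
  have hgf : ContDiff ℝ n (g ∘ f) := contDiff_iff_contDiffAt.mpr fun y =>
    hf.contDiffAt.rpow_const_of_ne (hfpos y).ne'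
  have hC : ∀ i, i ≤ n → ‖iteratedFDerivWithin ℝ i g (Set.Ioi 0) (f x)‖ ≤ M := by
    intro i hi
    rw [hfx]
    exact Finset.single_le_sum (f := fun i => ‖iteratedFDerivWithin ℝ i g (Set.Ioi 0) 1‖)
      (fun _ _ => norm_nonneg _) (Finset.mem_range.mpr (by omega))
  have hD : ∀ i, 1 ≤ i → i ≤ n → ‖iteratedFDeriv ℝ i f x‖ ≤ (2 * r⁻¹) ^ i := by
    intro i hi _
    have h1 : iteratedFDeriv ℝ i f x =
        (r ^ 2)⁻¹ • iteratedFDeriv ℝ i (fun y : E => ‖y‖ ^ 2) x := by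
      rw [fun_iteratedFDeriv_add_apply contDiffAt_const hsq'.contDiffAt,
        iteratedFDeriv_const_of_ne (by omega), Pi.zero_apply, zero_add]
      exact iteratedFDeriv_const_smul_apply' (R := ℝ) (F := ℝ) (a := (r ^ 2)⁻¹) hsq.contDiffAt
    rw [h1, norm_smul, Real.norm_of_nonneg (by positivity)]
    calc _ ≤ (r ^ 2)⁻¹ * (r ^ 2 * (2 * r⁻¹) ^ i) := by
          gcongr
          exact norm_iteratedFDeriv_norm_sq_le hr hxr i
      _ = _ := inv_mul_cancel_left₀ (by positivity) _
  have hcomp := norm_iteratedFDeriv_comp_le' (t := Set.Ioi (0 : ℝ))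
    (Set.range_subset_iff.mpr hfpos) (uniqueDiffOn_Ioi 0) hg hf le_rfl x hC hD
  rw [hfac, iteratedFDeriv_const_smul_apply' hgf.contDiffAt, norm_smul,
    Real.norm_of_nonneg (by positivity)]
  calc _ ≤ (r ^ 2) ^ s * (n.factorial * M * (2 * r⁻¹) ^ n) := by gcongr
    _ ≤ (r ^ 2) ^ s * (m.factorial * M * (2 * r⁻¹) ^ n) := by gcongr
    _ = _ := by ring

theorem exists_norm_iteratedFDeriv_add_norm_sq_rpow_smul_le (E : Type*) [NormedAddCommGroup E]
    [InnerProductSpace ℝ E] (s : ℝ) (m : ℕ) (hm : 2 * s + 1 ≤ m) :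
    ∃ K : ℝ, 0 ≤ K ∧ ∀ δ : ℝ, 0 < δ → ∀ x : E,
      ‖iteratedFDeriv ℝ m (fun y : E => (δ ^ 2 + ‖y‖ ^ 2) ^ s • y) x‖ ≤
        K * δ ^ (2 * s + 1 - m) := by
  obtain ⟨K, hK, h⟩ := exists_norm_iteratedFDeriv_add_norm_sq_rpow_le E s m
  refine ⟨K * 4 ^ m, by positivity, fun δ hδ x => ?_⟩
  set r := √(δ ^ 2 + ‖x‖ ^ 2)
  have hr : 0 < r := Real.sqrt_pos.mpr (by positivity)
  have hr2 : δ ^ 2 + ‖x‖ ^ 2 = r ^ 2 := (Real.sq_sqrt (by positivity)).symm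
  have hxr : ‖x‖ ≤ r := Real.le_sqrt_of_sq_le (by nlinarith)
  have hδr : δ ≤ r := Real.le_sqrt_of_sq_le (by nlinarith [sq_nonneg ‖x‖])
  refine (norm_iteratedFDeriv_smul_le (N := m) (contDiff_add_norm_sq_rpow hδ s)
    contDiff_fun_id x le_rfl).trans ?_
  refine (sum_choose_mul_le
    (a := fun i => ‖iteratedFDeriv ℝ i (fun y : E => (δ ^ 2 + ‖y‖ ^ 2) ^ s) x‖)
    (b := fun i => ‖iteratedFDeriv ℝ i (fun y : E => y) x‖) (L := r) hr.le
    (by positivity) hr one_le_two (fun _ => norm_nonneg _) (h δ r hδ hr x hr2)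
    (norm_iteratedFDeriv_id_le_mul_inv_pow hr hxr)).trans ?_
  have hpow : r ^ (2 * s + 1 - m) = (r ^ 2) ^ s * r * r⁻¹ ^ m := by
    rw [Real.rpow_sub hr, Real.rpow_add hr, Real.rpow_one, Real.rpow_natCast, Real.rpow_mul hr.le,
      Real.rpow_two, inv_pow, div_eq_mul_inv]
  calc _ = K * 4 ^ m * r ^ (2 * s + 1 - m) := by
        rw [hpow, mul_pow]
        norm_num
        ring
    _ ≤ K * 4 ^ m * δ ^ (2 * s + 1 - m) := by
        gcongr ?_ * ?_
        exact Real.rpow_le_rpow_of_nonpos hδ hδr (by linarith)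


/-- For `1 < p < 2` and an integer `m ≥ 1`, there is a constant `C_m > 0`
depending only on `m`, `p` and the dimension `d`, such that for all `ν∞ ≥ 0`, `ν > 0`,
`δ > 0` and every `A`, the `m`-th iterated Fréchet derivative of the regularized stress
`S(A) = (ν∞ + ν (δ² + |A|²)^((p-2)/2)) • A` satisfies
`‖D^m S(A)‖ ≤ C_m (ν∞ 𝟙_{m=1} + ν δ^(p-1-m))`. -/
theorem stmt_8 (d : ℕ) (p : ℝ) (hp1 : 1 < p) (hp2 : p < 2) (m : ℕ) (hm : 1 ≤ m) :
    ∃ C > 0, ∀ (νinf ν δ : ℝ), 0 ≤ νinf → 0 < ν → 0 < δ →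
      ∀ A : EuclideanSpace ℝ (Fin d × Fin d),
        ‖iteratedFDeriv ℝ m
            (fun B : EuclideanSpace ℝ (Fin d × Fin d) =>
              (νinf + ν * (δ ^ 2 + ‖B‖ ^ 2) ^ ((p - 2) / 2)) • B) A‖ ≤
          C * (νinf * (if m = 1 then 1 else 0) + ν * δ ^ (p - 1 - (m : ℝ))) := by
  have hm' : (1 : ℝ) ≤ m := by exact_mod_cast hm
  obtain ⟨K, hK, h⟩ := exists_norm_iteratedFDeriv_add_norm_sq_rpow_smul_le
    (EuclideanSpace ℝ (Fin d × Fin d)) ((p - 2) / 2) m (by linarith)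
  refine ⟨K + 1, by positivity, fun νinf ν δ hνinf hν hδ A => ?_⟩
  have hφ : ContDiff ℝ m (fun B : EuclideanSpace ℝ (Fin d × Fin d) =>
      (δ ^ 2 + ‖B‖ ^ 2) ^ ((p - 2) / 2) • B) :=
    (contDiff_add_norm_sq_rpow hδ _).smul contDiff_fun_id
  have hsplit : (fun B : EuclideanSpace ℝ (Fin d × Fin d) =>
      (νinf + ν * (δ ^ 2 + ‖B‖ ^ 2) ^ ((p - 2) / 2)) • B) =
      fun B => νinf • B + ν • ((δ ^ 2 + ‖B‖ ^ 2) ^ ((p - 2) / 2) • B) := by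
    ext1 B
    rw [add_smul, mul_smul]
  rw [hsplit, fun_iteratedFDeriv_add_apply (contDiff_fun_id.const_smul νinf).contDiffAt
    (hφ.const_smul ν).contDiffAt, iteratedFDeriv_const_smul_apply' contDiff_fun_id.contDiffAt,
    iteratedFDeriv_const_smul_apply' hφ.contDiffAt]
  refine (norm_add_le _ _).trans ?_
  rw [norm_smul, norm_smul, Real.norm_of_nonneg hνinf, Real.norm_of_nonneg hν.le]
  have h1 := norm_iteratedFDeriv_id_le hm A
  have h2 := h δ hδ A
  rw [show 2 * ((p - 2) / 2) + 1 - (m : ℝ) = p - 1 - m by ring] at h2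
  have hI : (0 : ℝ) ≤ if m = 1 then 1 else 0 := by split_ifs <;> norm_num
  have hδp : 0 < δ ^ (p - 1 - (m : ℝ)) := Real.rpow_pos_of_pos hδ _
  calc _ ≤ νinf * (if m = 1 then 1 else 0) + ν * (K * δ ^ (p - 1 - (m : ℝ))) := by gcongr
    _ ≤ (K + 1) * (νinf * (if m = 1 then 1 else 0) + ν * δ ^ (p - 1 - (m : ℝ))) := by
        nlinarith [mul_nonneg hK (mul_nonneg hνinf hI), mul_pos hν hδp]
end

section
/- Fix ν∞ ≥ 0, ν > 0, δ > 0 and 1 < p < 2. Then the regularized stress map S is strictly monotone on real d×d matrices: for all A ≠ B one has ⟨S(A) − S(B), A − B⟩ > 0. -/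
open scoped RealInnerProductSpace

/-- If `a ↦ φ a * a` is strictly increasing on norms and `φ` is positive, then `x ↦ φ ‖x‖ • x` is
strictly monotone. -/
theorem inner_smul_norm_sub_pos {E : Type*} [NormedAddCommGroup E] [InnerProductSpace ℝ E]
    {φ : ℝ → ℝ} (hpos : ∀ s, 0 ≤ s → 0 < φ s)
    (hmono : StrictMonoOn (fun s => φ s * s) (Set.Ici 0)) {x y : E} (hxy : x ≠ y) :
    0 < ⟪φ ‖x‖ • x - φ ‖y‖ • y, x - y⟫ := by
  rcases eq_or_ne ‖x‖ ‖y‖ with h | h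
  · rw [h, ← smul_sub, real_inner_smul_left]
    exact mul_pos (hpos _ (norm_nonneg y)) (real_inner_self_pos.2 (sub_ne_zero.2 hxy))
  · have hexp : ⟪φ ‖x‖ • x - φ ‖y‖ • y, x - y⟫ =
        (φ ‖x‖ * ‖x‖ - φ ‖y‖ * ‖y‖) * (‖x‖ - ‖y‖) +
          (φ ‖x‖ + φ ‖y‖) * (‖x‖ * ‖y‖ - ⟪x, y⟫) := by
      simp only [inner_sub_left, inner_sub_right, real_inner_smul_left,
        real_inner_self_eq_norm_sq, real_inner_comm x y]
      ring
    rw [hexp]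
    refine add_pos_of_pos_of_nonneg ?_ (mul_nonneg
      (add_pos (hpos _ (norm_nonneg x)) (hpos _ (norm_nonneg y))).le
      (sub_nonneg.2 (real_inner_le_norm x y)))
    rcases lt_or_gt_of_ne h with h | h
    · exact mul_pos_of_neg_of_neg
        (sub_neg.2 (hmono (norm_nonneg x) (norm_nonneg y) h)) (sub_neg.2 h)
    · exact mul_pos (sub_pos.2 (hmono (norm_nonneg y) (norm_nonneg x) h)) (sub_pos.2 h)

theorem strictMonoOn_rpow_add_sq_mul {δ p : ℝ} (hδ : 0 < δ) (hp1 : 1 < p) (hp2 : p < 2) :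
    StrictMonoOn (fun s : ℝ => (δ ^ 2 + s ^ 2) ^ ((p - 2) / 2) * s) (Set.Ici 0) := by
  intro a ha b hb hab
  rw [Set.mem_Ici] at ha hb
  have hsq (s : ℝ) : ((δ ^ 2 + s ^ 2) ^ ((p - 2) / 2) * s) ^ 2 =
      (δ ^ 2 + s ^ 2) ^ (p - 1) - δ ^ 2 * (δ ^ 2 + s ^ 2) ^ (p - 2) := by
    have hx : 0 < δ ^ 2 + s ^ 2 := by positivity
    have h1 : ((δ ^ 2 + s ^ 2) ^ ((p - 2) / 2)) ^ 2 = (δ ^ 2 + s ^ 2) ^ (p - 2) := by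
      rw [← Real.rpow_mul_natCast hx.le]
      norm_num
    have h2 : (δ ^ 2 + s ^ 2) ^ (p - 1) = (δ ^ 2 + s ^ 2) ^ (p - 2) * (δ ^ 2 + s ^ 2) := by
      rw [← Real.rpow_add_one hx.ne']
      ring_nf
    rw [mul_pow, h1, h2]
    ring
  have hx : 0 < δ ^ 2 + a ^ 2 := by positivity
  have hlt : δ ^ 2 + a ^ 2 < δ ^ 2 + b ^ 2 := by gcongr
  have hinc := Real.rpow_lt_rpow hx.le hlt (sub_pos.2 hp1)
  have hdec := Real.rpow_le_rpow_of_nonpos hx hlt.le (sub_neg.2 hp2).le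
  refine lt_of_pow_lt_pow_left₀ 2 (by positivity) ?_
  rw [hsq, hsq]
  linarith [mul_le_mul_of_nonneg_left hdec (sq_nonneg δ)]

/-- For `ν∞ ≥ 0`, `ν > 0`, `δ > 0` and `1 < p < 2`, the regularized stress map
`S(A) = (ν∞ + ν (δ² + |A|²)^((p-2)/2)) • A` is strictly monotone:
`⟪S(A) - S(B), A - B⟫ > 0` whenever `A ≠ B`. -/
theorem stmt_9 (d : ℕ) (νinf ν δ p : ℝ) (hνinf : 0 ≤ νinf) (hν : 0 < ν) (hδ : 0 < δ)
    (hp1 : 1 < p) (hp2 : p < 2)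
    (A B : EuclideanSpace ℝ (Fin d × Fin d)) (hAB : A ≠ B) :
    0 < ⟪(νinf + ν * (δ ^ 2 + ‖A‖ ^ 2) ^ ((p - 2) / 2)) • A -
          (νinf + ν * (δ ^ 2 + ‖B‖ ^ 2) ^ ((p - 2) / 2)) • B, A - B⟫ := by
  refine inner_smul_norm_sub_pos
    (φ := fun s => νinf + ν * (δ ^ 2 + s ^ 2) ^ ((p - 2) / 2)) (fun s _ => by positivity) ?_ hAB
  intro a ha b hb hab
  have h := mul_lt_mul_of_pos_left (strictMonoOn_rpow_add_sq_mul hδ hp1 hp2 ha hb hab) hν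
  have h' := mul_le_mul_of_nonneg_left hab.le hνinf
  dsimp only at h ⊢
  linarith
end

section
/- Fix ν∞ ≥ 0, ν > 0, δ > 0, 1 < p < 2, and a clipping factor s ∈ [0,1]. For a real d×d matrix A, set μ(A) = ν(δ² + |A|²)^{(p−2)/2} and η(A) = ν∞ + μ(A), and define the modified (stress-clipped) constitutive tangent T_s(B) = η(A)·B + s·(p−2)·(μ(A)/(δ² + |A|²))·⟨A,B⟩·A. Then T_s satisfies the two-sided ellipticity bounds (ν∞ + (p−1)·μ(A))·|B|² ≤ ⟨T_s(B),B⟩ ≤ (ν∞ + μ(A))·|B|² for all real d×d matrices B; in particular T_s is positive definite. -/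
open scoped RealInnerProductSpace

/-- For `ν∞ ≥ 0`, `ν > 0`, `δ > 0`, `1 < p < 2` and a clipping factor
`s ∈ [0,1]`, with `μ(A) = ν (δ² + |A|²)^((p-2)/2)` and `η(A) = ν∞ + μ(A)`, the modified
(stress-clipped) constitutive tangent
`T_s(B) = η(A) • B + s (p-2) (μ(A)/(δ² + |A|²)) ⟪A, B⟫ • A`
satisfies the two-sided ellipticity bounds
`(ν∞ + (p-1) μ(A)) |B|² ≤ ⟪T_s(B), B⟫ ≤ (ν∞ + μ(A)) |B|²`;
in particular `T_s` is positive definite. -/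
theorem stmt_17 (d : ℕ) (νinf ν δ p s : ℝ) (hνinf : 0 ≤ νinf) (hν : 0 < ν) (hδ : 0 < δ)
    (hp1 : 1 < p) (hp2 : p < 2) (hs0 : 0 ≤ s) (hs1 : s ≤ 1)
    (A : EuclideanSpace ℝ (Fin d × Fin d))
    (μA : ℝ) (hμA : μA = ν * (δ ^ 2 + ‖A‖ ^ 2) ^ ((p - 2) / 2)) :
    (∀ B : EuclideanSpace ℝ (Fin d × Fin d),
      (νinf + (p - 1) * μA) * ‖B‖ ^ 2 ≤
          ⟪(νinf + μA) • B + (s * (p - 2) * (μA / (δ ^ 2 + ‖A‖ ^ 2)) * ⟪A, B⟫) • A, B⟫ ∧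
        ⟪(νinf + μA) • B + (s * (p - 2) * (μA / (δ ^ 2 + ‖A‖ ^ 2)) * ⟪A, B⟫) • A, B⟫ ≤
          (νinf + μA) * ‖B‖ ^ 2) ∧
    (∀ B : EuclideanSpace ℝ (Fin d × Fin d), B ≠ 0 →
      0 < ⟪(νinf + μA) • B + (s * (p - 2) * (μA / (δ ^ 2 + ‖A‖ ^ 2)) * ⟪A, B⟫) • A, B⟫) := by
  have hD : 0 < δ ^ 2 + ‖A‖ ^ 2 := by positivity
  have hμ : 0 < μA := by rw [hμA]; positivity
  have bounds : ∀ B : EuclideanSpace ℝ (Fin d × Fin d),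
      (νinf + (p - 1) * μA) * ‖B‖ ^ 2 ≤
          ⟪(νinf + μA) • B + (s * (p - 2) * (μA / (δ ^ 2 + ‖A‖ ^ 2)) * ⟪A, B⟫) • A, B⟫ ∧
        ⟪(νinf + μA) • B + (s * (p - 2) * (μA / (δ ^ 2 + ‖A‖ ^ 2)) * ⟪A, B⟫) • A, B⟫ ≤
          (νinf + μA) * ‖B‖ ^ 2 := by
    intro B
    have key : ⟪(νinf + μA) • B + (s * (p - 2) * (μA / (δ ^ 2 + ‖A‖ ^ 2)) * ⟪A, B⟫) • A, B⟫ =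
        (νinf + μA) * ‖B‖ ^ 2 -
          (2 - p) * μA * (s * (⟪A, B⟫ ^ 2 / (δ ^ 2 + ‖A‖ ^ 2))) := by
      rw [inner_add_left, real_inner_smul_left, real_inner_smul_left, real_inner_self_eq_norm_sq]
      ring
    have hq0 : 0 ≤ ⟪A, B⟫ ^ 2 / (δ ^ 2 + ‖A‖ ^ 2) := by positivity
    have hq1 : ⟪A, B⟫ ^ 2 / (δ ^ 2 + ‖A‖ ^ 2) ≤ ‖B‖ ^ 2 := by
      rw [div_le_iff₀ hD]
      have cauchy_schwarz : ⟪A, B⟫ ^ 2 ≤ (‖A‖ * ‖B‖) ^ 2 :=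
        sq_le_sq.mpr ((abs_real_inner_le_norm A B).trans (le_abs_self _))
      nlinarith [mul_nonneg (sq_nonneg δ) (sq_nonneg ‖B‖)]
    have hsq : s * (⟪A, B⟫ ^ 2 / (δ ^ 2 + ‖A‖ ^ 2)) ≤ ‖B‖ ^ 2 :=
      (mul_le_of_le_one_left hq0 hs1).trans hq1
    have hc : 0 ≤ (2 - p) * μA := mul_nonneg (by linarith) hμ.le
    rw [key]
    constructor
    · linarith [mul_le_mul_of_nonneg_left hsq hc]
    · linarith [mul_nonneg hc (mul_nonneg hs0 hq0)]
  refine ⟨bounds, fun B hB => lt_of_lt_of_le ?_ (bounds B).1⟩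
  have hB' : 0 < ‖B‖ := norm_pos_iff.mpr hB
  have hp : 0 < p - 1 := sub_pos.mpr hp1
  positivity
end
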